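/- arXiv:2501.00565 — 3 statements merged into one kernel-verified Lean document; each statement's English description precedes it below -/
import Mathlib

section
/- Let d ≥ 1 and let V : ℝ^d → ℝ be C² with Z_V := ∫ e^{−V} < ∞, Z_{2V} := ∫ e^{−2V} < ∞, and ∇²V(x) ⪯ β I_d for all x (β > 0). Let Φ_t := p_t^{2V}/p_t^V be the ratio of forward Ornstein–Uhlenbeck densities started at μ² = e^{−2V}/Z_{2V} and at μ = e^{−V}/Z_V respectively. Then the supremum of Φ_t is nonincreasing in time: for all 0 < s ≤ t, sup_{z ∈ ℝ^d} Φ_t(z) ≤ sup_{z ∈ ℝ^d} Φ_s(z); moreover sup_{z} Φ_t(z) ≤ (Z_V²/Z_{2V}) (β/(2π))^{d/2} for every t > 0. -/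
open Real MeasureTheory
open scoped RealInnerProductSpace

/-- The forward Ornstein–Uhlenbeck density at time `t`, started at `μ = e^{-W}/∫ e^{-W}`. -/
noncomputable def ouDensity (d : ℕ) (W : EuclideanSpace ℝ (Fin d) → ℝ) (t : ℝ)
    (z : EuclideanSpace ℝ (Fin d)) : ℝ :=
  (2 * π * (1 - exp (-2 * t))) ^ (-(d : ℝ) / 2) *
    ∫ x : EuclideanSpace ℝ (Fin d),
      exp (-‖z - exp (-t) • x‖ ^ 2 / (2 * (1 - exp (-2 * t)))) *
        (exp (-W x) / ∫ y : EuclideanSpace ℝ (Fin d), exp (-W y))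

/-- The unnormalised Ornstein–Uhlenbeck transition kernel. -/
noncomputable def ouKernel {d : ℕ} (t : ℝ) (z x : EuclideanSpace ℝ (Fin d)) : ℝ :=
  exp (-‖z - exp (-t) • x‖ ^ 2 / (2 * (1 - exp (-2 * t))))

lemma one_sub_exp_neg_two_mul_pos {t : ℝ} (ht : 0 < t) : 0 < 1 - exp (-2 * t) := by
  have : exp (-2 * t) < 1 := Real.exp_lt_one_iff.2 (by linarith)
  linarith

lemma ouKernel_pos {d : ℕ} (t : ℝ) (z x : EuclideanSpace ℝ (Fin d)) : 0 < ouKernel t z x :=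
  exp_pos _

lemma ouKernel_le_one {d : ℕ} {t : ℝ} (ht : 0 < t) (z x : EuclideanSpace ℝ (Fin d)) :
    ouKernel t z x ≤ 1 := by
  have := one_sub_exp_neg_two_mul_pos ht
  refine exp_le_one_iff.2 ?_
  rw [neg_div]
  exact neg_nonpos.2 (by positivity)

lemma continuous_ouKernel {d : ℕ} (t : ℝ) :
    Continuous fun p : EuclideanSpace ℝ (Fin d) × EuclideanSpace ℝ (Fin d) =>
      ouKernel t p.1 p.2 := by
  unfold ouKernel
  fun_prop

lemma integrable_ouKernel_mul {d : ℕ} {t : ℝ} (ht : 0 < t) (z : EuclideanSpace ℝ (Fin d))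
    {w : EuclideanSpace ℝ (Fin d) → ℝ} (hw : Integrable w) :
    Integrable fun x => ouKernel t z x * w x := by
  have hc : Continuous fun x : EuclideanSpace ℝ (Fin d) => ouKernel t z x := by
    unfold ouKernel
    fun_prop
  refine hw.bdd_mul (c := 1) hc.aestronglyMeasurable (.of_forall fun x => ?_)
  rw [Real.norm_of_nonneg (ouKernel_pos t z x).le]
  exact ouKernel_le_one ht z x

lemma integrable_exp_neg_mul_sq_norm_sub {d : ℕ} {b : ℝ} (hb : 0 < b)
    (m : EuclideanSpace ℝ (Fin d)) :
    Integrable fun y : EuclideanSpace ℝ (Fin d) => exp (-b * ‖y - m‖ ^ 2) := by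
  have h := GaussianFourier.integrable_cexp_neg_mul_sq_norm_add
    (b := (b : ℂ)) (by simpa using hb) 0 (0 : EuclideanSpace ℝ (Fin d))
  have h2 : Integrable fun y : EuclideanSpace ℝ (Fin d) => exp (-b * ‖y‖ ^ 2) := by
    refine h.re.congr (.of_forall fun y => ?_)
    simp only [zero_mul, add_zero]
    rw [← Complex.ofReal_neg, ← Complex.ofReal_pow, ← Complex.ofReal_mul, ← Complex.ofReal_exp]
    rfl
  exact h2.comp_sub_right m

lemma ouKernel_exponent_add {E : Type*} [NormedAddCommGroup E] [InnerProductSpace ℝ E]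
    {a b : ℝ} (hA : 0 < 1 - a ^ 2) (hB : 0 < 1 - b ^ 2) (hC : 0 < 1 - (a * b) ^ 2) (x y z : E) :
    -‖z - a • y‖ ^ 2 / (2 * (1 - a ^ 2)) + -‖y - b • x‖ ^ 2 / (2 * (1 - b ^ 2)) =
      -((1 - (a * b) ^ 2) / (2 * (1 - a ^ 2) * (1 - b ^ 2))) *
          ‖y - (1 - (a * b) ^ 2)⁻¹ • ((a * (1 - b ^ 2)) • z + (b * (1 - a ^ 2)) • x)‖ ^ 2 +
        -‖z - (a * b) • x‖ ^ 2 / (2 * (1 - (a * b) ^ 2)) := by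
  simp only [norm_sub_sq_real, norm_add_sq_real, norm_smul, inner_smul_left, inner_smul_right,
    inner_add_right, mul_pow, Real.norm_eq_abs, sq_abs, conj_trivial]
  rw [real_inner_comm z y]
  have hC' : 1 - a ^ 2 * b ^ 2 ≠ 0 := by rw [← mul_pow]; exact hC.ne'
  field_simp
  ring

/-- Chapman–Kolmogorov for the unnormalised kernel. -/
lemma exists_integral_ouKernel_mul_ouKernel (d : ℕ) {r s : ℝ} (hr : 0 < r) (hs : 0 < s) :
    ∃ c : ℝ, 0 < c ∧ ∀ z x : EuclideanSpace ℝ (Fin d),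
      ∫ y, ouKernel r z y * ouKernel s y x = c * ouKernel (r + s) z x := by
  have hA := one_sub_exp_neg_two_mul_pos hr
  have hB := one_sub_exp_neg_two_mul_pos hs
  have hC := one_sub_exp_neg_two_mul_pos (add_pos hr hs)
  have e (u : ℝ) : exp (-2 * u) = exp (-u) ^ 2 := by
    rw [← Real.exp_nat_mul]; congr 1; push_cast; ring
  have e' : exp (-(r + s)) = exp (-r) * exp (-s) := by rw [← Real.exp_add]; congr 1; ring
  rw [e] at hA hB hC
  rw [e'] at hC
  set a := exp (-r) with ha
  set b := exp (-s) with hb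
  set k := (1 - (a * b) ^ 2) / (2 * (1 - a ^ 2) * (1 - b ^ 2)) with hk
  have hk0 : 0 < k := by positivity
  refine ⟨∫ y : EuclideanSpace ℝ (Fin d), exp (-k * ‖y‖ ^ 2), ?_, fun z x => ?_⟩
  · exact integral_exp_pos (by simpa using integrable_exp_neg_mul_sq_norm_sub hk0 0)
  · unfold ouKernel
    simp only [e, e', ← ha, ← hb, ← Real.exp_add]
    simp only [ouKernel_exponent_add hA hB hC, ← hk]
    simp only [Real.exp_add, integral_mul_const]
    congr 1
    exact integral_sub_right_eq_self
      (fun y : EuclideanSpace ℝ (Fin d) => exp (-k * ‖y‖ ^ 2)) _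

lemma integrable_prod_ouKernel_mul {d : ℕ} {r s : ℝ} (hr : 0 < r) (hs : 0 < s)
    (z : EuclideanSpace ℝ (Fin d)) {w : EuclideanSpace ℝ (Fin d) → ℝ} (hw : Integrable w) :
    Integrable (fun p : EuclideanSpace ℝ (Fin d) × EuclideanSpace ℝ (Fin d) =>
      ouKernel r z p.1 * (ouKernel s p.1 p.2 * w p.2)) (volume.prod volume) := by
  have hA := one_sub_exp_neg_two_mul_pos hr
  have hk : Integrable fun y : EuclideanSpace ℝ (Fin d) => ouKernel r z y := by
    have h := integrable_exp_neg_mul_sq_norm_sub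
      (b := exp (-r) ^ 2 / (2 * (1 - exp (-2 * r)))) (by positivity) (exp r • z)
    refine h.congr (.of_forall fun y => ?_)
    have : z - exp (-r) • y = -(exp (-r) • (y - exp r • z)) := by
      rw [smul_sub, smul_smul, ← Real.exp_add]; simp
    simp only [ouKernel]
    rw [this, norm_neg, norm_smul, Real.norm_of_nonneg (exp_pos _).le]
    congr 1
    ring
  have hc := (continuous_ouKernel (d := d) s).aestronglyMeasurable
    (μ := volume.prod volume)
  refine ((hk.mul_prod hw).bdd_mul (c := 1) hc (.of_forall fun p => ?_)).congr
    (.of_forall fun p => ?_)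
  · rw [Real.norm_of_nonneg (ouKernel_pos _ _ _).le]
    exact ouKernel_le_one hs _ _
  · ring

/-- Semigroup property of the unnormalised Ornstein–Uhlenbeck flow. -/
lemma integral_ouKernel_mul_integral_ouKernel {d : ℕ} {r s c : ℝ} (hr : 0 < r) (hs : 0 < s)
    (hc : ∀ z x : EuclideanSpace ℝ (Fin d),
      ∫ y, ouKernel r z y * ouKernel s y x = c * ouKernel (r + s) z x)
    (z : EuclideanSpace ℝ (Fin d)) {w : EuclideanSpace ℝ (Fin d) → ℝ} (hw : Integrable w) :
    ∫ y, ouKernel r z y * ∫ x, ouKernel s y x * w x =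
      c * ∫ x, ouKernel (r + s) z x * w x := by
  simp only [← integral_const_mul]
  rw [integral_integral_swap (integrable_prod_ouKernel_mul hr hs z hw)]
  refine integral_congr_ae (.of_forall fun x => ?_)
  simp only [← mul_assoc, integral_mul_const, hc]

lemma integral_ouKernel_mul_le_of_le {d : ℕ} {r s M : ℝ} (hr : 0 < r) (hs : 0 < s)
    {u w : EuclideanSpace ℝ (Fin d) → ℝ} (hu : Integrable u) (hw : Integrable w)
    (h : ∀ y, ∫ x, ouKernel s y x * u x ≤ M * ∫ x, ouKernel s y x * w x)
    (z : EuclideanSpace ℝ (Fin d)) :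
    ∫ x, ouKernel (r + s) z x * u x ≤ M * ∫ x, ouKernel (r + s) z x * w x := by
  obtain ⟨c, hc0, hc⟩ := exists_integral_ouKernel_mul_ouKernel d hr hs
  have hint {v : EuclideanSpace ℝ (Fin d) → ℝ} (hv : Integrable v) :
      Integrable fun y => ouKernel r z y * ∫ x, ouKernel s y x * v x := by
    have := (integrable_prod_ouKernel_mul hr hs z hv).integral_prod_left
    simpa only [integral_const_mul] using this
  refine le_of_mul_le_mul_left ?_ hc0
  rw [mul_left_comm, ← integral_ouKernel_mul_integral_ouKernel hr hs hc z hu,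
    ← integral_ouKernel_mul_integral_ouKernel hr hs hc z hw, ← integral_const_mul]
  refine integral_mono (hint hu) ((hint hw).const_mul M) fun y => ?_
  have := mul_le_mul_of_nonneg_left (h y) (ouKernel_pos r z y).le
  simp only
  linarith

/-- Second-order Taylor upper bound from an upper bound on the Hessian. -/
lemma le_taylor_of_hessian_le {E : Type*} [NormedAddCommGroup E] [NormedSpace ℝ E]
    {V : E → ℝ} (hV : ContDiff ℝ 2 V) {β : ℝ}
    (hhess : ∀ x v : E, iteratedFDeriv ℝ 2 V x ![v, v] ≤ β * ‖v‖ ^ 2) (x h : E) :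
    V (x + h) ≤ V x + fderiv ℝ V x h + β / 2 * ‖h‖ ^ 2 := by
  have hl (τ : ℝ) : HasDerivAt (fun τ : ℝ => x + τ • h) h τ := by
    simpa using ((hasDerivAt_id τ).smul_const h).const_add x
  have h1 (τ : ℝ) : HasDerivAt (fun τ : ℝ => V (x + τ • h)) (fderiv ℝ V (x + τ • h) h) τ :=
    ((hV.differentiable (by norm_num)) _).hasFDerivAt.comp_hasDerivAt τ (hl τ)
  have h2 (τ : ℝ) : HasDerivAt (fun τ : ℝ => fderiv ℝ V (x + τ • h) h)
      (iteratedFDeriv ℝ 2 V (x + τ • h) ![h, h]) τ := by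
    have hd : Differentiable ℝ (fderiv ℝ V) :=
      (hV.fderiv_right (m := 1) (by norm_num)).differentiable (by norm_num)
    have hc : HasDerivAt (fun τ : ℝ => fderiv ℝ V (x + τ • h))
        (fderiv ℝ (fderiv ℝ V) (x + τ • h) h) τ :=
      (hd (x + τ • h)).hasFDerivAt.comp_hasDerivAt τ (hl τ)
    rw [iteratedFDeriv_two_apply]
    simpa using hc.clm_apply (hasDerivAt_const τ h)
  have h3 (τ : ℝ) : HasDerivAt
      (fun τ : ℝ => fderiv ℝ V x h + β * τ * ‖h‖ ^ 2 - fderiv ℝ V (x + τ • h) h)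
      (β * ‖h‖ ^ 2 - iteratedFDeriv ℝ 2 V (x + τ • h) ![h, h]) τ := by
    have := ((((hasDerivAt_id τ).const_mul β).mul_const (‖h‖ ^ 2)).const_add
      (fderiv ℝ V x h)).sub (h2 τ)
    exact this.congr_deriv (by rw [mul_one])
  have h4 (τ : ℝ) : HasDerivAt
      (fun τ : ℝ => V x + fderiv ℝ V x h * τ + β / 2 * ‖h‖ ^ 2 * τ ^ 2 - V (x + τ • h))
      (fderiv ℝ V x h + β * τ * ‖h‖ ^ 2 - fderiv ℝ V (x + τ • h) h) τ := by
    have := ((((hasDerivAt_id τ).const_mul (fderiv ℝ V x h)).const_add (V x)).add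
      ((hasDerivAt_pow 2 τ).const_mul (β / 2 * ‖h‖ ^ 2))).sub (h1 τ)
    refine this.congr_deriv ?_
    push_cast
    ring
  have m1 : Monotone
      fun τ : ℝ => fderiv ℝ V x h + β * τ * ‖h‖ ^ 2 - fderiv ℝ V (x + τ • h) h := by
    refine monotone_of_deriv_nonneg (fun τ => (h3 τ).differentiableAt) fun τ => ?_
    rw [(h3 τ).deriv]
    exact sub_nonneg.2 (hhess _ _)
  have m2 : MonotoneOn
      (fun τ : ℝ => V x + fderiv ℝ V x h * τ + β / 2 * ‖h‖ ^ 2 * τ ^ 2 - V (x + τ • h))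
      (Set.Icc 0 1) := by
    refine monotoneOn_of_deriv_nonneg (convex_Icc 0 1)
      (fun τ _ => (h4 τ).continuousAt.continuousWithinAt)
      (fun τ _ => (h4 τ).differentiableAt.differentiableWithinAt) fun τ hτ => ?_
    rw [(h4 τ).deriv]
    rw [interior_Icc] at hτ
    simpa using m1 hτ.1.le
  have := m2 (Set.left_mem_Icc.2 zero_le_one) (Set.right_mem_Icc.2 zero_le_one) zero_le_one
  simp only [zero_smul, one_smul, add_zero, mul_zero, mul_one, one_pow, ne_eq,
    OfNat.ofNat_ne_zero, not_false_eq_true, zero_pow, sub_self] at this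
  linarith

/-- A `β`-semi-log-convex density is bounded by the mass times the peak of a Gaussian. -/
lemma exp_neg_le_integral_mul {d : ℕ} {V : EuclideanSpace ℝ (Fin d) → ℝ}
    (hV : ContDiff ℝ 2 V) (hint : Integrable fun x => exp (-V x)) {β : ℝ} (hβ : 0 < β)
    (hhess : ∀ x v : EuclideanSpace ℝ (Fin d),
      iteratedFDeriv ℝ 2 V x ![v, v] ≤ β * ‖v‖ ^ 2) (x : EuclideanSpace ℝ (Fin d)) :
    exp (-V x) ≤ (∫ y, exp (-V y)) * (β / (2 * π)) ^ ((d : ℝ) / 2) := by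
  set w := (InnerProductSpace.toDual ℝ (EuclideanSpace ℝ (Fin d))).symm (fderiv ℝ V x) with hw
  set m := x - β⁻¹ • w with hm
  have key (y : EuclideanSpace ℝ (Fin d)) : V y ≤ V x + β / 2 * ‖y - m‖ ^ 2 := by
    have h1 := le_taylor_of_hessian_le hV hhess x (y - x)
    have h2 : fderiv ℝ V x (y - x) = ⟪w, y - x⟫ := by
      rw [hw, InnerProductSpace.toDual_symm_apply]
    have h3 : y - m = (y - x) + β⁻¹ • w := by rw [hm]; abel
    rw [h3, norm_add_sq_real, norm_smul, inner_smul_right, real_inner_comm, ← h2]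
    rw [add_sub_cancel] at h1
    have h4 : 0 ≤ β / 2 * (‖β⁻¹‖ * ‖w‖) ^ 2 := by positivity
    have h5 : β / 2 * (2 * (β⁻¹ * fderiv ℝ V x (y - x))) = fderiv ℝ V x (y - x) := by
      field_simp
    linarith
  have hb : 0 < β / 2 := by positivity
  have hgauss : ∫ y : EuclideanSpace ℝ (Fin d), exp (-(β / 2) * ‖y - m‖ ^ 2) =
      (2 * π / β) ^ ((d : ℝ) / 2) := by
    rw [integral_sub_right_eq_self
      (fun y : EuclideanSpace ℝ (Fin d) => exp (-(β / 2) * ‖y‖ ^ 2)) m,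
      GaussianFourier.integral_rexp_neg_mul_sq_norm hb, finrank_euclideanSpace_fin]
    congr 1
    field_simp
  have hle : exp (-V x) * (2 * π / β) ^ ((d : ℝ) / 2) ≤ ∫ y, exp (-V y) := by
    rw [← hgauss, ← integral_const_mul]
    refine integral_mono ((integrable_exp_neg_mul_sq_norm_sub hb m).const_mul _) hint fun y => ?_
    simp only [← Real.exp_add]
    exact exp_le_exp.2 (by linarith [key y])
  have hinv : (2 * π / β) ^ ((d : ℝ) / 2) * (β / (2 * π)) ^ ((d : ℝ) / 2) = 1 := by
    rw [← Real.mul_rpow (by positivity) (by positivity)]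
    have : 2 * π / β * (β / (2 * π)) = 1 := by field_simp
    rw [this, Real.one_rpow]
  calc exp (-V x)
      = exp (-V x) * (2 * π / β) ^ ((d : ℝ) / 2) * (β / (2 * π)) ^ ((d : ℝ) / 2) := by
        rw [mul_assoc, hinv, mul_one]
    _ ≤ _ := mul_le_mul_of_nonneg_right hle (by positivity)

lemma ouDensity_div_ouDensity {d : ℕ} (U W : EuclideanSpace ℝ (Fin d) → ℝ) {t : ℝ}
    (ht : 0 < t) (z : EuclideanSpace ℝ (Fin d)) :
    ouDensity d U t z / ouDensity d W t z =
      (∫ x, ouKernel t z x * (exp (-U x) / ∫ y, exp (-U y))) /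
        ∫ x, ouKernel t z x * (exp (-W x) / ∫ y, exp (-W y)) := by
  have := one_sub_exp_neg_two_mul_pos ht
  exact mul_div_mul_left _ _ (by positivity)

/-- For `μ = e^{-V}/Z_V` `β`-semi-log-convex (`β > 0`), the supremum of the
ratio `Φ_t = p_t^{2V}/p_t^V` is nonincreasing in time, and is bounded by
`(Z_V²/Z_{2V}) (β/(2π))^{d/2}` for every `t > 0`. -/
theorem ratio_sup_decreasing_and_bounded
    (d : ℕ) (hd : 1 ≤ d) (V : EuclideanSpace ℝ (Fin d) → ℝ)
    (hV : ContDiff ℝ 2 V)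
    (hint : Integrable fun x : EuclideanSpace ℝ (Fin d) => exp (-V x))
    (hint2 : Integrable fun x : EuclideanSpace ℝ (Fin d) => exp (-(2 * V x)))
    (β : ℝ) (hβ : 0 < β)
    (hhess : ∀ x v : EuclideanSpace ℝ (Fin d),
      iteratedFDeriv ℝ 2 V x ![v, v] ≤ β * ‖v‖ ^ 2) :
    (∀ s t : ℝ, 0 < s → s ≤ t →
      (⨆ z : EuclideanSpace ℝ (Fin d),
          ouDensity d (fun x => 2 * V x) t z / ouDensity d V t z) ≤
        ⨆ z : EuclideanSpace ℝ (Fin d),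
          ouDensity d (fun x => 2 * V x) s z / ouDensity d V s z) ∧
    ∀ t : ℝ, 0 < t →
      (⨆ z : EuclideanSpace ℝ (Fin d),
          ouDensity d (fun x => 2 * V x) t z / ouDensity d V t z) ≤
        ((∫ x : EuclideanSpace ℝ (Fin d), exp (-V x)) ^ 2 /
            ∫ x : EuclideanSpace ℝ (Fin d), exp (-(2 * V x))) *
          (β / (2 * π)) ^ ((d : ℝ) / 2) := by
  set Z := ∫ x : EuclideanSpace ℝ (Fin d), exp (-V x) with hZ
  set Z₂ := ∫ x : EuclideanSpace ℝ (Fin d), exp (-(2 * V x)) with hZ₂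
  set M := Z ^ 2 / Z₂ * (β / (2 * π)) ^ ((d : ℝ) / 2) with hM
  have hZ0 : 0 < Z := integral_exp_pos hint
  have hZ₂0 : 0 < Z₂ := integral_exp_pos hint2
  have hu : Integrable fun x => exp (-(2 * V x)) / Z₂ := hint2.div_const _
  have hw : Integrable fun x => exp (-V x) / Z := hint.div_const _
  have hpos {t : ℝ} (ht : 0 < t) (z : EuclideanSpace ℝ (Fin d)) :
      0 < ∫ x, ouKernel t z x * (exp (-V x) / Z) := by
    have h := integrable_ouKernel_mul ht z hint
    simp only [← mul_div_assoc, integral_div]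
    refine div_pos ?_ hZ0
    simp only [ouKernel, ← Real.exp_add] at h ⊢
    exact integral_exp_pos h
  have hpt (x : EuclideanSpace ℝ (Fin d)) :
      exp (-(2 * V x)) / Z₂ ≤ M * (exp (-V x) / Z) := by
    have h := mul_le_mul_of_nonneg_left (exp_neg_le_integral_mul hV hint hβ hhess x)
      (exp_pos (-V x)).le
    rw [← Real.exp_add, show -V x + -V x = -(2 * V x) by ring, ← hZ] at h
    rw [div_le_iff₀ hZ₂0]
    refine h.trans_eq ?_
    rw [hM]
    field_simp
  have hbound {t : ℝ} (ht : 0 < t) (z : EuclideanSpace ℝ (Fin d)) :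
      ouDensity d (fun x => 2 * V x) t z / ouDensity d V t z ≤ M := by
    rw [ouDensity_div_ouDensity _ _ ht, div_le_iff₀ (hpos ht z), ← integral_const_mul]
    refine integral_mono (integrable_ouKernel_mul ht z hu)
      ((integrable_ouKernel_mul ht z hw).const_mul M) fun x => ?_
    have := mul_le_mul_of_nonneg_left (hpt x) (ouKernel_pos t z x).le
    simp only
    linarith
  refine ⟨fun s t hs hst => ?_, fun t ht => ciSup_le (hbound ht)⟩
  obtain rfl | hlt := hst.eq_or_lt
  · exact le_rfl
  refine ciSup_le fun z => ?_
  rw [ouDensity_div_ouDensity _ _ (hs.trans hlt), div_le_iff₀ (hpos (hs.trans hlt) z)]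
  have h := integral_ouKernel_mul_le_of_le (sub_pos.2 hlt) hs hu hw
    (M := ⨆ z, ouDensity d (fun x => 2 * V x) s z / ouDensity d V s z) (fun y => ?_) z
  · rwa [sub_add_cancel] at h
  · rw [← div_le_iff₀ (hpos hs y)]
    have h := le_ciSup (f := fun z => ouDensity d (fun x => 2 * V x) s z / ouDensity d V s z)
      ⟨M, Set.forall_mem_range.2 (hbound hs)⟩ y
    rwa [ouDensity_div_ouDensity _ _ hs y] at h
end

section
/- Let d ≥ 1, let V : ℝ^d → ℝ be continuous with Z_V := ∫ e^{−V} < ∞, let t > 0, and let Y ~ N(0, (1−e^{−2t}) I_d). Then for every z ∈ ℝ^d, the forward Ornstein–Uhlenbeck density p_t^V started at μ = e^{−V}/Z_V satisfies p_t^V(z) = (e^{td}/Z_V) · E[e^{−V(e^t(z−Y))}], and its score satisfies ∇ log p_t^V(z) = E[−Y e^{−V(e^t(z−Y))}] / ((1−e^{−2t}) · E[e^{−V(e^t(z−Y))}]). -/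
open Real MeasureTheory
open scoped RealInnerProductSpace

/-- The density of the centered Gaussian `N(0, s I_d)` on `ℝ^d`. -/
noncomputable def gaussDens (d : ℕ) (s : ℝ) (y : EuclideanSpace ℝ (Fin d)) : ℝ :=
  (2 * π * s) ^ (-(d : ℝ) / 2) * exp (-‖y‖ ^ 2 / (2 * s))

lemma integral_comp_smul_sub {d : ℕ} {G : Type*} [NormedAddCommGroup G] [NormedSpace ℝ G]
    (F : EuclideanSpace ℝ (Fin d) → EuclideanSpace ℝ (Fin d) → G) (t : ℝ)
    (z : EuclideanSpace ℝ (Fin d)) :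
    ∫ y, F y (exp t • (z - y)) = exp (-(t * d)) • ∫ x, F (z - exp (-t) • x) x := by
  have h1 : ∀ y, F y (exp t • (z - y)) =
      (fun x => F (z - exp (-t) • (exp t • x)) (exp t • x)) (z - y) := fun y => by
    simp [smul_smul, ← exp_add]
  simp_rw [h1]
  rw [integral_sub_left_eq_self (μ := volume)
      (fun x => F (z - exp (-t) • (exp t • x)) (exp t • x)) z,
    Measure.integral_comp_smul volume (fun x => F (z - exp (-t) • x) x) (exp t)]
  congr 1
  rw [finrank_euclideanSpace_fin, ← exp_nat_mul, ← exp_neg, abs_of_pos (exp_pos _), mul_comm]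

lemma mul_exp_neg_sq_div_le {s : ℝ} (hs : 0 < s) (r : ℝ) :
    r * exp (-r ^ 2 / (2 * s)) ≤ 1 + 2 * s := by
  have h1 : r ^ 2 / (2 * s) + 1 ≤ exp (r ^ 2 / (2 * s)) := add_one_le_exp _
  have h2 : r ^ 2 = 2 * s * (r ^ 2 / (2 * s)) := by field_simp
  have h3 : 0 ≤ r ^ 2 / (2 * s) := by positivity
  rw [neg_div, exp_neg, ← div_eq_mul_inv, div_le_iff₀ (exp_pos _)]
  nlinarith [sq_nonneg (r - 1), mul_le_mul_of_nonneg_left h1 (by positivity : 0 ≤ 1 + 2 * s)]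

lemma hasGradientAt_exp_neg_norm_sq {E : Type*} [NormedAddCommGroup E] [InnerProductSpace ℝ E]
    [CompleteSpace E] (s b : ℝ) (a w : E) :
    HasGradientAt (fun w => exp (-‖w - a‖ ^ 2 / (2 * s)) * b)
      ((exp (-‖w - a‖ ^ 2 / (2 * s)) * b) • (s⁻¹ • -(w - a))) w := by
  rw [hasGradientAt_iff_hasFDerivAt]
  have h := (((((hasFDerivAt_id w).sub_const a).norm_sq.neg).mul_const (2 * s)⁻¹).exp).mul_const b
  simp only [id, ← div_eq_mul_inv] at h
  refine h.congr_fderiv ?_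
  ext v
  simp
  ring

/-- Differentiation under the integral sign for a Gaussian convolution. -/
lemma hasGradientAt_integral_exp_neg_norm_sq {d : ℕ} {s : ℝ} (hs : 0 < s) (c : ℝ)
    {f : EuclideanSpace ℝ (Fin d) → ℝ} (hf : Integrable f) (z : EuclideanSpace ℝ (Fin d)) :
    HasGradientAt (fun w => ∫ x, exp (-‖w - c • x‖ ^ 2 / (2 * s)) * f x)
      (∫ x, (exp (-‖z - c • x‖ ^ 2 / (2 * s)) * f x) • (s⁻¹ • -(z - c • x))) z := by
  have hmeas : ∀ w : EuclideanSpace ℝ (Fin d), AEStronglyMeasurable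
      (fun x => exp (-‖w - c • x‖ ^ 2 / (2 * s)) * f x) := fun w =>
    (Continuous.aestronglyMeasurable (by fun_prop)).mul hf.aestronglyMeasurable
  rw [hasGradientAt_iff_hasFDerivAt]
  have key := hasFDerivAt_integral_of_dominated_of_fderiv_le (𝕜 := ℝ) (μ := volume)
    (F := fun w x => exp (-‖w - c • x‖ ^ 2 / (2 * s)) * f x)
    (F' := fun w x => InnerProductSpace.toDual ℝ (EuclideanSpace ℝ (Fin d))
      ((exp (-‖w - c • x‖ ^ 2 / (2 * s)) * f x) • (s⁻¹ • -(w - c • x))))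
    (x₀ := z) (s := Set.univ) (bound := fun x => (s⁻¹ * (1 + 2 * s)) * ‖f x‖)
    Filter.univ_mem (Filter.Eventually.of_forall hmeas) ?_ ?_ ?_ (hf.norm.const_mul _) ?_
  · refine key.congr_fderiv ?_
    exact ((InnerProductSpace.toDual ℝ (EuclideanSpace ℝ (Fin d))).toContinuousLinearEquiv
      |>.integral_comp_comm _)
  · refine hf.norm.mono (hmeas z) (Filter.Eventually.of_forall fun x => ?_)
    rw [norm_mul, norm_norm, norm_of_nonneg (exp_pos _).le]
    refine mul_le_of_le_one_left (norm_nonneg _) (exp_le_one_iff.2 ?_)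
    rw [neg_div]
    exact neg_nonpos.2 (by positivity)
  · refine (InnerProductSpace.toDual ℝ
      (EuclideanSpace ℝ (Fin d))).continuous.comp_aestronglyMeasurable ?_
    exact (hmeas z).smul (Continuous.aestronglyMeasurable (by fun_prop))
  · refine Filter.Eventually.of_forall fun x w _ => ?_
    rw [LinearIsometryEquiv.norm_map, norm_smul, norm_smul, norm_neg, norm_mul,
      norm_of_nonneg (exp_pos _).le, norm_of_nonneg (inv_pos.2 hs).le]
    calc _ = s⁻¹ * (‖w - c • x‖ * exp (-‖w - c • x‖ ^ 2 / (2 * s))) * ‖f x‖ := by ring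
      _ ≤ _ := by
        gcongr
        exact mul_exp_neg_sq_div_le hs _
  · exact Filter.Eventually.of_forall fun x w _ =>
      (hasGradientAt_iff_hasFDerivAt.1 (hasGradientAt_exp_neg_norm_sq s (f x) (c • x) w))

lemma ouDensity_eq {d : ℕ} (V : EuclideanSpace ℝ (Fin d) → ℝ) (t : ℝ)
    (w : EuclideanSpace ℝ (Fin d)) :
    ouDensity d V t w = ((2 * π * (1 - exp (-2 * t))) ^ (-(d : ℝ) / 2) / ∫ y, exp (-V y)) *
      ∫ x, exp (-‖w - exp (-t) • x‖ ^ 2 / (2 * (1 - exp (-2 * t)))) * exp (-V x) := by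
  simp_rw [ouDensity, ← mul_div_assoc]
  rw [integral_div]
  ring

/-- Tweedie's formulas. For a continuous potential `V` with `∫ e^{-V} < ∞`,
`t > 0` and `Y ∼ N(0, (1-e^{-2t}) I_d)`, for every `z`:
`p_t^V(z) = (e^{td}/Z_V) E[e^{-V(e^t(z-Y))}]` and
`∇ log p_t^V(z) = E[-Y e^{-V(e^t(z-Y))}] / ((1-e^{-2t}) E[e^{-V(e^t(z-Y))}])`,
the expectations being written as integrals against the Gaussian density. -/
theorem tweedie_density_and_score
    (d : ℕ) (hd : 1 ≤ d) (V : EuclideanSpace ℝ (Fin d) → ℝ)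
    (hV : Continuous V)
    (hint : Integrable fun x : EuclideanSpace ℝ (Fin d) => exp (-V x))
    (t : ℝ) (ht : 0 < t) (z : EuclideanSpace ℝ (Fin d)) :
    ouDensity d V t z =
      (exp (t * d) / ∫ x : EuclideanSpace ℝ (Fin d), exp (-V x)) *
        ∫ y : EuclideanSpace ℝ (Fin d),
          gaussDens d (1 - exp (-2 * t)) y * exp (-V (exp t • (z - y))) ∧
    gradient (fun w => Real.log (ouDensity d V t w)) z =
      ((1 - exp (-2 * t)) *
          ∫ y : EuclideanSpace ℝ (Fin d),
            gaussDens d (1 - exp (-2 * t)) y * exp (-V (exp t • (z - y))))⁻¹ •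
        ∫ y : EuclideanSpace ℝ (Fin d),
          (gaussDens d (1 - exp (-2 * t)) y * exp (-V (exp t • (z - y)))) • (-y) := by
  have hs : 0 < 1 - exp (-2 * t) := by
    have : exp (-2 * t) < 1 := by
      rw [← exp_zero]
      exact exp_lt_exp.2 (by linarith)
    linarith
  set s := 1 - exp (-2 * t)
  set C := (2 * π * s) ^ (-(d : ℝ) / 2) with hC_def
  have hC : 0 < C := by positivity
  have hZ : 0 < ∫ y, exp (-V y) := integral_exp_pos hint
  set Z := ∫ y, exp (-V y)
  have hou : ∀ w, ouDensity d V t w =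
      (C / Z) * ∫ x, exp (-‖w - exp (-t) • x‖ ^ 2 / (2 * s)) * exp (-V x) := ouDensity_eq V t
  have hE : ∫ y, gaussDens d s y * exp (-V (exp t • (z - y))) =
      exp (-(t * d)) * (C * ∫ x, exp (-‖z - exp (-t) • x‖ ^ 2 / (2 * s)) * exp (-V x)) := by
    rw [integral_comp_smul_sub (fun y x => gaussDens d s y * exp (-V x)) t z, smul_eq_mul,
      ← integral_const_mul C]
    simp only [gaussDens, ← hC_def, mul_assoc C]
  have hEY : ∫ y, (gaussDens d s y * exp (-V (exp t • (z - y)))) • (-y) =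
      (exp (-(t * d)) * C * s) • ∫ x, (exp (-‖z - exp (-t) • x‖ ^ 2 / (2 * s)) *
        exp (-V x)) • (s⁻¹ • -(z - exp (-t) • x)) := by
    rw [integral_comp_smul_sub (fun y x => (gaussDens d s y * exp (-V x)) • (-y)) t z,
      mul_assoc, mul_smul, ← integral_smul (C * s)]
    congr 2
    ext1 x
    simp only [gaussDens, ← hC_def, smul_smul]
    congr 1
    field_simp
  have hI : 0 < ∫ x, exp (-‖z - exp (-t) • x‖ ^ 2 / (2 * s)) * exp (-V x) := by
    simp_rw [← exp_add]
    refine integral_exp_pos (hint.mono (Continuous.aestronglyMeasurable (by fun_prop))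
      (Filter.Eventually.of_forall fun x => ?_))
    rw [norm_of_nonneg (exp_pos _).le, norm_of_nonneg (exp_pos _).le, exp_le_exp, neg_div]
    linarith [show 0 ≤ ‖z - exp (-t) • x‖ ^ 2 / (2 * s) by positivity]
  refine ⟨?_, ?_⟩
  · rw [hou, hE, exp_neg (t * d)]
    field_simp
  · have hG := hasGradientAt_integral_exp_neg_norm_sq hs (exp (-t)) hint z
    simp_rw [hou]
    rw [hE, hEY]
    refine HasGradientAt.gradient ?_
    rw [hasGradientAt_iff_hasFDerivAt] at hG ⊢
    refine ((hG.const_mul (C / Z)).log (by positivity)).congr_fderiv ?_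
    rw [smul_smul, smul_smul, map_smul]
    congr 1
    field_simp
end

section
/- Let d ≥ 1, let V : ℝ^d → ℝ be continuous with Z_V := ∫ e^{−V} < ∞ and ∫ ‖x‖² e^{−V(x)} dx < ∞, let t > 0, and let Y ~ N(0, (1−e^{−2t}) I_d). Then for every z ∈ ℝ^d, the Hessian of the log of the forward Ornstein–Uhlenbeck density p_t^V started at μ = e^{−V}/Z_V satisfies ∇² log p_t^V(z) = E[Y Yᵀ e^{−V(e^t(z−Y))}] / ((1−e^{−2t})² E[e^{−V(e^t(z−Y))}]) − I_d/(1−e^{−2t}) − (∇ log p_t^V(z))(∇ log p_t^V(z))ᵀ. -/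
open Real MeasureTheory
open scoped RealInnerProductSpace

section WeightedTranslates

variable {E F : Type*} [NormedAddCommGroup E] [NormedSpace ℝ E] [MeasurableSpace E] [BorelSpace E]
  [SecondCountableTopology E] [NormedAddCommGroup F] [NormedSpace ℝ F]

/-- A bounded continuous function of `w - a • x` is integrable against an integrable weight. -/
theorem integrable_weight_smul_translate {μ : Measure E} {m : E → ℝ} (hm : Integrable m μ)
    (a : ℝ) {g : E → F} (hg : Continuous g) {B : ℝ} (hB : ∀ u, ‖g u‖ ≤ B) (w : E) :
    Integrable (fun x => m x • g (w - a • x)) μ := by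
  refine hm.smul_bdd (φ := m) (f := fun x => g (w - a • x)) B ?_
    (Filter.Eventually.of_forall fun x => hB _)
  exact (hg.comp (by fun_prop)).aestronglyMeasurable

/-- Differentiation under the integral sign for weighted translates of a function that is bounded
with bounded continuous derivative. -/
theorem hasFDerivAt_integral_weight_smul_translate {μ : Measure E} {m : E → ℝ}
    (hm : Integrable m μ) (a : ℝ) {g : E → F} {g' : E → E →L[ℝ] F}
    (hg : ∀ u, HasFDerivAt g (g' u) u) (hg' : Continuous g') {B C : ℝ}
    (hB : ∀ u, ‖g u‖ ≤ B) (hC : ∀ u, ‖g' u‖ ≤ C) (w : E) :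
    HasFDerivAt (fun w => ∫ x, m x • g (w - a • x) ∂μ) (∫ x, m x • g' (w - a • x) ∂μ) w := by
  have hgc : Continuous g := continuous_iff_continuousAt.2 fun u => (hg u).continuousAt
  refine hasFDerivAt_integral_of_dominated_of_fderiv_le (bound := fun x => ‖m x‖ * C)
    (F' := fun w x => m x • g' (w - a • x)) Filter.univ_mem
    (Filter.Eventually.of_forall fun w =>
      (integrable_weight_smul_translate hm a hgc hB w).aestronglyMeasurable)
    (integrable_weight_smul_translate hm a hgc hB w)
    (integrable_weight_smul_translate hm a hg' hC w).aestronglyMeasurable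
    (Filter.Eventually.of_forall fun x w _ => ?_) (hm.norm.mul_const C)
    (Filter.Eventually.of_forall fun x w _ => ?_)
  · rw [norm_smul]
    exact mul_le_mul_of_nonneg_left (hC _) (norm_nonneg _)
  · have h : HasFDerivAt (fun w => w - a • x) (ContinuousLinearMap.id ℝ E) w :=
      (hasFDerivAt_id w).sub_const _
    exact ((hg (w - a • x)).comp w h).const_smul (m x)

end WeightedTranslates

section GaussianKernel

variable {E : Type*} [NormedAddCommGroup E]

/-- The unnormalised Gaussian kernel of variance `s`. -/
noncomputable def gaussKernel (s : ℝ) (u : E) : ℝ := exp (-‖u‖ ^ 2 / (2 * s))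

theorem continuous_gaussKernel (s : ℝ) : Continuous (gaussKernel s : E → ℝ) := by
  unfold gaussKernel
  fun_prop

theorem gaussKernel_pos (s : ℝ) (u : E) : 0 < gaussKernel s u := exp_pos _

theorem gaussKernel_le_one {s : ℝ} (hs : 0 < s) (u : E) : gaussKernel s u ≤ 1 := by
  rw [gaussKernel, exp_le_one_iff, neg_div, neg_nonpos]
  positivity

theorem sq_norm_mul_gaussKernel_le {s : ℝ} (hs : 0 < s) (u : E) :
    ‖u‖ ^ 2 * gaussKernel s u ≤ 2 * s := by
  have h : ‖u‖ ^ 2 / (2 * s) ≤ exp (‖u‖ ^ 2 / (2 * s)) := by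
    linarith [add_one_le_exp (‖u‖ ^ 2 / (2 * s))]
  rw [gaussKernel, neg_div, exp_neg, ← div_eq_mul_inv, div_le_iff₀ (exp_pos _)]
  rwa [div_le_iff₀' (by positivity)] at h

variable [InnerProductSpace ℝ E]

set_option maxSynthPendingDepth 3

variable (E) in
/-- The real inner product as a continuous bilinear map, with a linear first argument. -/
noncomputable def realInnerCLM : E →L[ℝ] E →L[ℝ] ℝ := innerSL ℝ

@[simp]
theorem realInnerCLM_apply (u v : E) : realInnerCLM E u v = ⟪u, v⟫ := rfl

@[simp]
theorem norm_realInnerCLM_apply (u : E) : ‖realInnerCLM E u‖ = ‖u‖ :=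
  innerSL_apply_norm (𝕜 := ℝ) u

/-- The first derivative of `gaussKernel`. -/
noncomputable def gaussKernelFDeriv (s : ℝ) (u : E) : E →L[ℝ] ℝ :=
  (-(gaussKernel s u / s)) • realInnerCLM E u

/-- The second derivative of `gaussKernel`. -/
noncomputable def gaussKernelFDeriv₂ (s : ℝ) (u : E) : E →L[ℝ] E →L[ℝ] ℝ :=
  (-(gaussKernel s u / s)) • realInnerCLM E +
    ((-s⁻¹) • gaussKernelFDeriv s u).smulRight (realInnerCLM E u)

theorem continuous_gaussKernelFDeriv (s : ℝ) : Continuous (gaussKernelFDeriv s : E → E →L[ℝ] ℝ) :=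
  ((continuous_gaussKernel s).div_const s).neg.smul (realInnerCLM E).continuous

theorem continuous_gaussKernelFDeriv₂ (s : ℝ) :
    Continuous (gaussKernelFDeriv₂ s : E → E →L[ℝ] E →L[ℝ] ℝ) := by
  have h : Continuous fun u : E =>
      ContinuousLinearMap.smulRightL ℝ E (E →L[ℝ] ℝ) ((-s⁻¹) • gaussKernelFDeriv s u)
        (realInnerCLM E u) :=
    ((ContinuousLinearMap.smulRightL ℝ E (E →L[ℝ] ℝ)).continuous.comp
      ((continuous_gaussKernelFDeriv s).const_smul (-s⁻¹))).clm_apply (realInnerCLM E).continuous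
  exact (((continuous_gaussKernel s).div_const s).neg.smul (continuous_const
    (y := realInnerCLM E))).add h

theorem hasFDerivAt_gaussKernel (s : ℝ) (u : E) :
    HasFDerivAt (gaussKernel s) (gaussKernelFDeriv s u) u := by
  have h := (((hasStrictFDerivAt_norm_sq u).hasFDerivAt.neg).mul_const (2 * s)⁻¹).exp
  refine h.congr_fderiv ?_
  ext v
  simp [gaussKernelFDeriv, gaussKernel, div_eq_mul_inv]
  ring

theorem hasFDerivAt_gaussKernelFDeriv (s : ℝ) (u : E) :
    HasFDerivAt (gaussKernelFDeriv s) (gaussKernelFDeriv₂ s u) u := by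
  have h := (((hasFDerivAt_gaussKernel s u).mul_const s⁻¹).neg).smul
    (realInnerCLM E).hasFDerivAt
  refine h.congr_fderiv ?_
  ext v w
  simp [gaussKernelFDeriv₂, div_eq_mul_inv]

theorem gaussKernelFDeriv₂_apply (s : ℝ) (u v w : E) :
    gaussKernelFDeriv₂ s u v w =
      gaussKernel s u * (⟪u, v⟫ * ⟪u, w⟫) / s ^ 2 - ⟪v, w⟫ / s * gaussKernel s u := by
  simp [gaussKernelFDeriv₂, gaussKernelFDeriv, div_eq_mul_inv]
  ring

theorem norm_gaussKernelFDeriv {s : ℝ} (hs : 0 < s) (u : E) :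
    ‖gaussKernelFDeriv s u‖ = gaussKernel s u / s * ‖u‖ := by
  rw [gaussKernelFDeriv, norm_smul, norm_neg, norm_realInnerCLM_apply, Real.norm_of_nonneg]
  exact div_nonneg (gaussKernel_pos s u).le hs.le

theorem norm_gaussKernelFDeriv_le {s : ℝ} (hs : 0 < s) (u : E) :
    ‖gaussKernelFDeriv s u‖ ≤ (1 + 2 * s) / s := by
  have h₁ := gaussKernel_pos s u
  rw [norm_gaussKernelFDeriv hs, div_mul_eq_mul_div]
  gcongr
  nlinarith [gaussKernel_le_one hs u, sq_norm_mul_gaussKernel_le hs u,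
    mul_nonneg h₁.le (sq_nonneg (‖u‖ - 1))]

theorem norm_gaussKernelFDeriv₂_le {s : ℝ} (hs : 0 < s) (u : E) :
    ‖gaussKernelFDeriv₂ s u‖ ≤ 3 / s := by
  have h₁ := gaussKernel_pos s u
  have hl : ‖realInnerCLM E‖ ≤ 1 :=
    ContinuousLinearMap.opNorm_le_bound _ zero_le_one fun v => by simp
  calc ‖gaussKernelFDeriv₂ s u‖
      ≤ gaussKernel s u / s * 1 + s⁻¹ * (gaussKernel s u / s * ‖u‖) * ‖u‖ := by
        refine (norm_add_le (_ : E →L[ℝ] E →L[ℝ] ℝ) _).trans (add_le_add ?_ (le_of_eq ?_))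
        · rw [norm_smul, norm_neg, Real.norm_of_nonneg (by positivity)]
          gcongr
        · rw [ContinuousLinearMap.norm_smulRight_apply, norm_smul, norm_neg,
            norm_gaussKernelFDeriv hs, norm_realInnerCLM_apply, Real.norm_of_nonneg (by positivity)]
    _ = (gaussKernel s u + ‖u‖ ^ 2 * gaussKernel s u / s) / s := by
        field_simp
    _ ≤ 3 / s := by
        have h₂ : ‖u‖ ^ 2 * gaussKernel s u / s ≤ 2 :=
          (div_le_iff₀ hs).2 (sq_norm_mul_gaussKernel_le hs u)
        have h₃ := gaussKernel_le_one hs u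
        gcongr
        linarith

end GaussianKernel

/-- The Hessian of `log N` in terms of the first two derivatives of `N`. -/
theorem fderiv_fderiv_log_apply {E : Type*} [NormedAddCommGroup E] [NormedSpace ℝ E]
    {N : E → ℝ} {N' : E → E →L[ℝ] ℝ} {N'' : E →L[ℝ] E →L[ℝ] ℝ} {z : E}
    (hpos : ∀ w, 0 < N w) (h₁ : ∀ w, HasFDerivAt N (N' w) w) (h₂ : HasFDerivAt N' N'' z)
    (u v : E) :
    fderiv ℝ (fderiv ℝ fun w => log (N w)) z u v =
      N'' u v / N z - fderiv ℝ (fun w => log (N w)) z u * fderiv ℝ (fun w => log (N w)) z v := by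
  have h : (fderiv ℝ fun w => log (N w)) = fun w => (N w)⁻¹ • N' w :=
    funext fun w => ((h₁ w).log (hpos w).ne').fderiv
  have hinv : HasFDerivAt (fun w => (N w)⁻¹) (-(N z ^ 2)⁻¹ • N' z) z :=
    (hasDerivAt_inv (hpos z).ne').comp_hasFDerivAt z (h₁ z)
  have hz := (hpos z).ne'
  have hd : fderiv ℝ (fun w => (N w)⁻¹ • N' w) z = _ := (hinv.smul h₂).fderiv
  rw [h, hd]
  simp
  field_simp
  ring

theorem integral_eq_pow_mul_integral_translate {d : ℕ} (t : ℝ) (z : EuclideanSpace ℝ (Fin d))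
    (G : EuclideanSpace ℝ (Fin d) → ℝ) :
    ∫ y, G y = exp (-t) ^ d * ∫ x, G (z - exp (-t) • x) := by
  rw [Measure.integral_comp_smul volume (fun y => G (z - y)), integral_sub_left_eq_self G]
  rw [finrank_euclideanSpace_fin, smul_eq_mul, abs_of_pos (by positivity),
    mul_inv_cancel_left₀ (by positivity)]

/-- Tweedie's formula for the Hessian. For a continuous potential `V` with
`∫ e^{-V} < ∞` and `∫ ‖x‖² e^{-V} < ∞`, `t > 0` and `Y ∼ N(0, (1-e^{-2t}) I_d)`, the entries
(in the standard orthonormal basis) of the Hessian of `log p_t^V` at `z` are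
`(∇² log p_t^V(z))_{ij} = E[Y_i Y_j e^{-V(e^t(z-Y))}] / ((1-e^{-2t})² E[e^{-V(e^t(z-Y))}])
  - δ_{ij}/(1-e^{-2t}) - (∇ log p_t^V(z))_i (∇ log p_t^V(z))_j`. -/
theorem tweedie_hessian
    (d : ℕ) (hd : 1 ≤ d) (V : EuclideanSpace ℝ (Fin d) → ℝ)
    (hV : Continuous V)
    (hint : Integrable fun x : EuclideanSpace ℝ (Fin d) => exp (-V x))
    (hm2 : Integrable fun x : EuclideanSpace ℝ (Fin d) => ‖x‖ ^ 2 * exp (-V x))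
    (t : ℝ) (ht : 0 < t) (z : EuclideanSpace ℝ (Fin d)) :
    ∀ i j : Fin d,
      iteratedFDeriv ℝ 2 (fun w => Real.log (ouDensity d V t w)) z
          ![EuclideanSpace.single i 1, EuclideanSpace.single j 1] =
        (∫ y : EuclideanSpace ℝ (Fin d),
            gaussDens d (1 - exp (-2 * t)) y * exp (-V (exp t • (z - y))) * (y i * y j)) /
          ((1 - exp (-2 * t)) ^ 2 *
            ∫ y : EuclideanSpace ℝ (Fin d),
              gaussDens d (1 - exp (-2 * t)) y * exp (-V (exp t • (z - y)))) -
        (if i = j then (1 : ℝ) else 0) / (1 - exp (-2 * t)) -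
        gradient (fun w => Real.log (ouDensity d V t w)) z i *
          gradient (fun w => Real.log (ouDensity d V t w)) z j := by
  intro i j
  set s : ℝ := 1 - exp (-2 * t) with hs_def
  have hs : 0 < s := by
    rw [hs_def, sub_pos, exp_lt_one_iff]
    linarith
  set a : ℝ := exp (-t) with ha
  set m : EuclideanSpace ℝ (Fin d) → ℝ := fun x => exp (-V x) with hm
  set N : EuclideanSpace ℝ (Fin d) → ℝ := fun w => ∫ x, m x • gaussKernel s (w - a • x) with hN
  have hb₀ : ∀ u : EuclideanSpace ℝ (Fin d), ‖gaussKernel s u‖ ≤ 1 := fun u => by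
    rw [Real.norm_of_nonneg (gaussKernel_pos s u).le]
    exact gaussKernel_le_one hs u
  have hi₀ := integrable_weight_smul_translate hint a (continuous_gaussKernel s) hb₀
  set_option maxSynthPendingDepth 3 in
  have hi₂ := integrable_weight_smul_translate hint a (continuous_gaussKernelFDeriv₂ s)
    (norm_gaussKernelFDeriv₂_le hs)
  have h₁ := hasFDerivAt_integral_weight_smul_translate hint a (hasFDerivAt_gaussKernel s)
    (continuous_gaussKernelFDeriv s) hb₀ (norm_gaussKernelFDeriv_le hs)
  have h₂ := hasFDerivAt_integral_weight_smul_translate hint a (hasFDerivAt_gaussKernelFDeriv s)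
    (continuous_gaussKernelFDeriv₂ s) (norm_gaussKernelFDeriv_le hs)
    (norm_gaussKernelFDeriv₂_le hs) z
  have hNpos : ∀ w, 0 < N w := fun w => by
    have h : ∀ x, m x • gaussKernel s (w - a • x) =
        exp (-V x + -‖w - a • x‖ ^ 2 / (2 * s)) := fun x => (exp_add _ _).symm
    simp only [hN, h]
    exact integral_exp_pos ((hi₀ w).congr (Filter.Eventually.of_forall h))
  obtain ⟨c, hc⟩ : ∃ c, (fun w => log (ouDensity d V t w)) = fun w => c + log (N w) := by
    have hZ : 0 < ∫ y, m y := integral_exp_pos hint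
    refine ⟨log ((2 * π * s) ^ (-(d : ℝ) / 2) / ∫ y, m y), funext fun w => ?_⟩
    rw [← log_mul (by positivity) (hNpos w).ne', div_mul_eq_mul_div, mul_div_assoc, ouDensity, hN,
      ← integral_div]
    congr 3
    ext x
    rw [smul_eq_mul, mul_comm (m x), mul_div_assoc]
    rfl
  have hgrad : ∀ k, gradient (fun w => log (ouDensity d V t w)) z k =
      fderiv ℝ (fun w => log (N w)) z (EuclideanSpace.single k 1) := fun k => by
    rw [hc, gradient, fderiv_const_add, ← InnerProductSpace.toDual_symm_apply,
      EuclideanSpace.inner_single_right]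
    simp
  have hfd : fderiv ℝ (fun w => c + log (N w)) = fderiv ℝ fun w => log (N w) :=
    funext fun w => fderiv_const_add c
  rw [hgrad, hgrad, hc, iteratedFDeriv_two_apply, hfd]
  simp only [Matrix.cons_val_zero, Matrix.cons_val_one]
  rw [fderiv_fderiv_log_apply hNpos h₁ h₂]
  congr 1
  set K : ℝ := (2 * π * s) ^ (-(d : ℝ) / 2) with hK
  have hKpos : 0 < K := by positivity
  have hdens : ∀ x, gaussDens d s (z - a • x) * exp (-V (exp t • (z - (z - a • x)))) =
      K * (m x • gaussKernel s (z - a • x)) := fun x => by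
    rw [sub_sub_cancel, ha, smul_smul, ← exp_add, add_neg_cancel, exp_zero, one_smul, gaussDens,
      ← gaussKernel, smul_eq_mul]
    ring
  have hden : ∫ y, gaussDens d s y * exp (-V (exp t • (z - y))) = a ^ d * (K * N z) := by
    rw [integral_eq_pow_mul_integral_translate t z]
    simp only [← ha, hdens, integral_const_mul, hN]
  set M : ℝ := ∫ x, m x • (gaussKernel s (z - a • x) * ((z - a • x) i * (z - a • x) j)) with hM
  have hnum : ∫ y, gaussDens d s y * exp (-V (exp t • (z - y))) * (y i * y j) =
      a ^ d * (K * M) := by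
    rw [integral_eq_pow_mul_integral_translate t z, hM]
    simp only [← ha, hdens, smul_eq_mul, mul_assoc, integral_const_mul]
  have hδ : ⟪EuclideanSpace.single i (1 : ℝ), EuclideanSpace.single j (1 : ℝ)⟫ =
      if i = j then (1 : ℝ) else 0 := by
    simp [EuclideanSpace.inner_single_left]
  have hpt : ∀ x, (m x • gaussKernelFDeriv₂ s (z - a • x)) (EuclideanSpace.single i 1)
      (EuclideanSpace.single j 1) =
      m x • (gaussKernel s (z - a • x) * ((z - a • x) i * (z - a • x) j)) / s ^ 2 -
        (if i = j then (1 : ℝ) else 0) / s * (m x • gaussKernel s (z - a • x)) := fun x => by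
    rw [smul_apply, smul_apply, gaussKernelFDeriv₂_apply, hδ,
      EuclideanSpace.inner_single_right, EuclideanSpace.inner_single_right]
    simp only [smul_eq_mul, one_mul, conj_trivial]
    ring
  have happ : (∫ x, m x • gaussKernelFDeriv₂ s (z - a • x)) (EuclideanSpace.single i 1)
      (EuclideanSpace.single j 1) =
      M / s ^ 2 - (if i = j then (1 : ℝ) else 0) / s * N z := by
    have hi := ((hi₂ z).apply_continuousLinearMap (EuclideanSpace.single i 1)
      ).apply_continuousLinearMap (EuclideanSpace.single j 1)
    rw [ContinuousLinearMap.integral_apply (hi₂ z), ContinuousLinearMap.integral_apply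
      ((hi₂ z).apply_continuousLinearMap _)]
    simp only [hpt] at hi ⊢
    have hi' := (hi₀ z).const_mul ((if i = j then (1 : ℝ) else 0) / s)
    rw [integral_sub ((hi.add hi').congr (Filter.Eventually.of_forall fun x => sub_add_cancel _ _))
      hi', integral_div, integral_const_mul]
  have hNz := (hNpos z).ne'
  have ha' : a ≠ 0 := (exp_pos _).ne'
  rw [happ, hden, hnum]
  field_simp
end
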